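/- Let Φ denote the standard normal CDF, logit(p) = log p − log(1−p) for p ∈ (0,1), and let a_L < 0 < a_U and b be real constants. Define f(t) = Φ(a_U√t + b) − Φ(a_L√t + b) for t > 0. Then f(t) ∈ (0,1) for all t > 0, the function g(t) = logit(f(t)) is differentiable for sufficiently large t, and lim_{t→∞} g′(t) = min{a_U², a_L²}/2. (This is Theorem 1(b) of the paper in the case θ ∈ (δ_L, δ_U), where a_U = (δ_U − θ_k)/√(I_{k,k}(θ)^{−1}) > 0 and a_L = (δ_L − θ_k)/√(I_{k,k}(θ)^{−1}) < 0.) -/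

import Mathlib

open Filter Real

/-- The standard normal CDF: Φ(x) = ∫_{−∞}^{x} e^{−t²/2}/√(2π) dt. -/
noncomputable def stdNormCDF (x : ℝ) : ℝ :=
  ∫ t in Set.Iic x, Real.exp (-t ^ 2 / 2) / Real.sqrt (2 * Real.pi)

/-- logit(p) = log p − log(1−p). -/
noncomputable def logit (p : ℝ) : ℝ := Real.log p - Real.log (1 - p)

/-- The standard normal density. -/
noncomputable def stdNormPDF (x : ℝ) : ℝ :=
  Real.exp (-x ^ 2 / 2) / Real.sqrt (2 * Real.pi)

lemma stdNormPDF_pos (x : ℝ) : 0 < stdNormPDF x := by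
  unfold stdNormPDF; positivity

lemma stdNormPDF_neg (x : ℝ) : stdNormPDF (-x) = stdNormPDF x := by
  simp [stdNormPDF]

lemma continuous_stdNormPDF : Continuous stdNormPDF := by
  unfold stdNormPDF; fun_prop

lemma gaussianPDFReal_zero_one :
    ProbabilityTheory.gaussianPDFReal 0 1 = stdNormPDF := by
  ext x
  simp [ProbabilityTheory.gaussianPDFReal, stdNormPDF, div_eq_inv_mul]

lemma integrable_stdNormPDF : MeasureTheory.Integrable stdNormPDF := by
  rw [← gaussianPDFReal_zero_one]
  exact ProbabilityTheory.integrable_gaussianPDFReal 0 1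

lemma integral_stdNormPDF : ∫ x, stdNormPDF x = 1 := by
  rw [← gaussianPDFReal_zero_one]
  exact ProbabilityTheory.integral_gaussianPDFReal_eq_one 0 one_ne_zero

lemma stdNormCDF_eq_integral (x : ℝ) : stdNormCDF x = ∫ t in Set.Iic x, stdNormPDF t := rfl

lemma stdNormCDF_eq_cdf :
    stdNormCDF = ProbabilityTheory.cdf (ProbabilityTheory.gaussianReal 0 1) := by
  ext x
  rw [ProbabilityTheory.cdf_eq_real, MeasureTheory.measureReal_def,
    ProbabilityTheory.gaussianReal_apply_eq_integral 0 one_ne_zero, gaussianPDFReal_zero_one,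
    ENNReal.toReal_ofReal
      (MeasureTheory.integral_nonneg fun t => (stdNormPDF_pos t).le), stdNormCDF_eq_integral]

lemma stdNormCDF_add_stdNormCDF_neg (x : ℝ) : stdNormCDF x + stdNormCDF (-x) = 1 := by
  have h : stdNormCDF (-x) = ∫ t in Set.Ioi x, stdNormPDF t := by
    rw [stdNormCDF_eq_integral, ← integral_comp_neg_Ioi]
    simp [stdNormPDF_neg]
  rw [h, stdNormCDF_eq_integral, ← Set.compl_Iic,
    MeasureTheory.integral_add_compl measurableSet_Iic integrable_stdNormPDF, integral_stdNormPDF]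

lemma hasDerivAt_stdNormCDF (x : ℝ) : HasDerivAt stdNormCDF (stdNormPDF x) x := by
  have h : stdNormCDF = fun y => stdNormCDF 0 + ∫ t in (0 : ℝ)..y, stdNormPDF t := by
    ext y
    rw [← intervalIntegral.integral_Iic_sub_Iic integrable_stdNormPDF.integrableOn
      integrable_stdNormPDF.integrableOn, ← stdNormCDF_eq_integral, ← stdNormCDF_eq_integral]
    ring
  rw [h]
  exact (continuous_stdNormPDF.integral_hasStrictDerivAt 0 x).hasDerivAt.const_add _

lemma strictMono_stdNormCDF : StrictMono stdNormCDF :=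
  strictMono_of_deriv_pos fun x => by
    rw [(hasDerivAt_stdNormCDF x).deriv]; exact stdNormPDF_pos x

lemma stdNormCDF_pos (x : ℝ) : 0 < stdNormCDF x := by
  have h : 0 ≤ stdNormCDF (x - 1) := by
    rw [stdNormCDF_eq_cdf]; exact ProbabilityTheory.cdf_nonneg _ _
  exact h.trans_lt (strictMono_stdNormCDF (by linarith))

lemma stdNormCDF_lt_one (x : ℝ) : stdNormCDF x < 1 := by
  linarith [stdNormCDF_add_stdNormCDF_neg x, stdNormCDF_pos (-x)]

lemma tendsto_stdNormCDF_neg_atTop :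
    Tendsto (fun x => stdNormCDF (-x)) atTop (nhds 0) := by
  rw [stdNormCDF_eq_cdf]
  exact (ProbabilityTheory.tendsto_cdf_atBot _).comp tendsto_neg_atTop_atBot

lemma hasDerivAt_stdNormPDF (x : ℝ) : HasDerivAt stdNormPDF (-x * stdNormPDF x) x := by
  have h : HasDerivAt (fun y : ℝ => -y ^ 2 / 2) (-x) x := by
    refine ((hasDerivAt_pow 2 x).neg.div_const 2).congr_deriv ?_
    norm_num
    ring
  refine (h.exp.div_const (Real.sqrt (2 * Real.pi))).congr_deriv ?_
  unfold stdNormPDF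
  ring

lemma stdNormPDF_eq_mul_exp (x y : ℝ) :
    stdNormPDF y = stdNormPDF x * Real.exp ((x ^ 2 - y ^ 2) / 2) := by
  unfold stdNormPDF
  rw [div_mul_eq_mul_div, ← Real.exp_add]
  ring_nf

lemma tendsto_stdNormPDF_atTop : Tendsto stdNormPDF atTop (nhds 0) := by
  have h : Tendsto (fun x : ℝ => -x ^ 2 / 2) atTop atBot :=
    (tendsto_neg_atTop_atBot.comp (tendsto_pow_atTop two_ne_zero)).atBot_div_const two_pos
  have h2 := (Real.tendsto_exp_atBot.comp h).div_const (Real.sqrt (2 * Real.pi))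
  rw [zero_div] at h2
  exact h2

/-- Asymptotics of the Mills ratio: `Φ(-x) ∼ φ(x) / x` as `x → ∞`. -/
lemma tendsto_mills_ratio :
    Tendsto (fun x => stdNormCDF (-x) / (stdNormPDF x / x)) atTop (nhds 1) := by
  refine HasDerivAt.lhopital_zero_atTop (f' := fun x => -stdNormPDF x)
    (g' := fun x => -stdNormPDF x * (1 + (x⁻¹) ^ 2)) ?_ ?_ ?_
    tendsto_stdNormCDF_neg_atTop (tendsto_stdNormPDF_atTop.div_atTop tendsto_id) ?_
  · refine Eventually.of_forall fun x => ?_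
    refine ((hasDerivAt_stdNormCDF (-x)).comp x (hasDerivAt_neg x)).congr_deriv ?_
    rw [stdNormPDF_neg, mul_neg_one]
  · filter_upwards [eventually_gt_atTop 0] with x hx
    refine ((hasDerivAt_stdNormPDF x).div (hasDerivAt_id x) hx.ne').congr_deriv ?_
    simp only [id]
    field_simp
    ring
  · refine Eventually.of_forall fun x => ?_
    have := stdNormPDF_pos x
    have h : 0 < stdNormPDF x * (1 + (x⁻¹) ^ 2) := by positivity
    simpa using h.ne'
  · have h : Tendsto (fun x : ℝ => (1 + (x⁻¹) ^ 2)⁻¹) atTop (nhds 1) := by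
      simpa using (((tendsto_inv_atTop_zero (𝕜 := ℝ)).pow 2).const_add 1).inv₀ (by norm_num)
    refine h.congr fun x => ?_
    have := (stdNormPDF_pos x).ne'
    have h2 : (1 + (x⁻¹) ^ 2) ≠ 0 := by positivity
    field_simp

lemma tendsto_affine_atTop {α : ℝ} (hα : 0 < α) (c : ℝ) :
    Tendsto (fun s => α * s + c) atTop atTop :=
  tendsto_atTop_add_const_right _ c (tendsto_id.const_mul_atTop hα)

lemma tendsto_affine_div (α c : ℝ) :
    Tendsto (fun s => (α * s + c) / s) atTop (nhds α) := by
  have h : Tendsto (fun s : ℝ => α + c / s) atTop (nhds (α + 0)) :=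
    (tendsto_const_nhds.div_atTop tendsto_id).const_add α
  rw [add_zero] at h
  refine h.congr' ?_
  filter_upwards [eventually_gt_atTop 0] with s hs
  field_simp

/-- The rescaled hazard rate of the normal law along an affine function. -/
lemma tendsto_hazard_affine {α : ℝ} (hα : 0 < α) (c : ℝ) :
    Tendsto (fun s => α * stdNormPDF (α * s + c) / (2 * s) / stdNormCDF (-(α * s + c)))
      atTop (nhds (α ^ 2 / 2)) := by
  have h1 := (tendsto_mills_ratio.comp (tendsto_affine_atTop hα c)).inv₀ one_ne_zero
  have h2 := ((tendsto_affine_div α c).const_mul (α / 2)).mul h1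
  have e : α / 2 * α * 1⁻¹ = α ^ 2 / 2 := by ring
  rw [e] at h2
  refine h2.congr' ?_
  filter_upwards [eventually_gt_atTop 0,
    (tendsto_affine_atTop hα c).eventually_gt_atTop 0] with s hs hu
  have := (stdNormCDF_pos (-(α * s + c))).ne'
  have := (stdNormPDF_pos (α * s + c)).ne'
  simp only [Function.comp]
  field_simp

lemma tendsto_quadratic_atBot {k : ℝ} (hk : k < 0) (c d : ℝ) :
    Tendsto (fun s => k * s ^ 2 + c * s + d) atTop atBot := by
  have h := ((tendsto_affine_div k c).neg_mul_atTop hk (tendsto_pow_atTop two_ne_zero))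
  refine tendsto_atBot_add_const_right _ d (h.congr' ?_)
  filter_upwards [eventually_gt_atTop 0] with s hs
  field_simp

lemma tendsto_tail_ratio {α β : ℝ} (hα : 0 < α) (hαβ : α < β) (c d : ℝ) :
    Tendsto (fun s => stdNormCDF (-(β * s + d)) / stdNormCDF (-(α * s + c)))
      atTop (nhds 0) := by
  have hβ := hα.trans hαβ
  have h1 := tendsto_mills_ratio.comp (tendsto_affine_atTop hβ d)
  have h2 := (tendsto_mills_ratio.comp (tendsto_affine_atTop hα c)).inv₀ one_ne_zero
  have h3 := (tendsto_affine_div α c).div (tendsto_affine_div β d) hβ.ne'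
  have h4 : Tendsto (fun s => Real.exp (((α * s + c) ^ 2 - (β * s + d) ^ 2) / 2))
      atTop (nhds 0) := by
    refine Real.tendsto_exp_atBot.comp ?_
    refine (tendsto_quadratic_atBot (k := (α ^ 2 - β ^ 2) / 2) (by nlinarith)
      (α * c - β * d) ((c ^ 2 - d ^ 2) / 2)).congr fun s => ?_
    ring
  have h := ((h1.mul h2).mul h3).mul h4
  rw [mul_zero] at h
  refine h.congr' ?_
  filter_upwards [eventually_gt_atTop 0, (tendsto_affine_atTop hα c).eventually_gt_atTop 0,
    (tendsto_affine_atTop hβ d).eventually_gt_atTop 0] with s hs hu hv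
  have := (stdNormCDF_pos (-(α * s + c))).ne'
  have := (stdNormPDF_pos (α * s + c)).ne'
  simp only [Function.comp, Pi.div_apply]
  rw [stdNormPDF_eq_mul_exp (α * s + c) (β * s + d)]
  generalize α * s + c = u at *
  generalize β * s + d = v at *
  field_simp

/-- A mediant tends to the smaller of the two limits when its weight dominates. -/
lemma tendsto_mediant {ι : Type*} {l : Filter ι} {p q P Q : ι → ℝ} {x y : ℝ}
    (hP : ∀ i, 0 < P i) (hQ : ∀ i, 0 < Q i)
    (hp : Tendsto (fun i => p i / P i) l (nhds x))
    (hq : Tendsto (fun i => q i / Q i) l (nhds y))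
    (h : x = y ∨ Tendsto (fun i => Q i / P i) l (nhds 0)) :
    Tendsto (fun i => (p i + q i) / (P i + Q i)) l (nhds x) := by
  rcases h with rfl | h
  · have hmin := hp.min hq
    have hmax := hp.max hq
    rw [min_self] at hmin
    rw [max_self] at hmax
    refine tendsto_of_tendsto_of_tendsto_of_le_of_le hmin hmax (fun i => ?_) fun i => ?_
    · have h1 := (le_div_iff₀ (hP i)).1 (min_le_left (p i / P i) (q i / Q i))
      have h2 := (le_div_iff₀ (hQ i)).1 (min_le_right (p i / P i) (q i / Q i))
      rw [le_div_iff₀ (add_pos (hP i) (hQ i))]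
      linarith
    · have h1 := (div_le_iff₀ (hP i)).1 (le_max_left (p i / P i) (q i / Q i))
      have h2 := (div_le_iff₀ (hQ i)).1 (le_max_right (p i / P i) (q i / Q i))
      rw [div_le_iff₀ (add_pos (hP i) (hQ i))]
      linarith
  · have h1 := (hp.add (hq.mul h)).div (h.const_add 1) (by norm_num)
    have e : (x + y * 0) / (1 + 0) = x := by ring
    rw [e] at h1
    refine h1.congr fun i => ?_
    have := (hP i).ne'
    have := (hQ i).ne'
    have := (add_pos (hP i) (hQ i)).ne'
    simp only [Pi.div_apply]
    field_simp

lemma tendsto_two_sided_hazard_of_le {α β : ℝ} (hα : 0 < α) (hαβ : α ≤ β) (c d : ℝ) :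
    Tendsto (fun s =>
      (α * stdNormPDF (α * s + c) / (2 * s) + β * stdNormPDF (β * s + d) / (2 * s)) /
        (stdNormCDF (-(α * s + c)) + stdNormCDF (-(β * s + d)))) atTop (nhds (α ^ 2 / 2)) := by
  refine tendsto_mediant (fun s => stdNormCDF_pos _) (fun s => stdNormCDF_pos _)
    (tendsto_hazard_affine hα c) (tendsto_hazard_affine (hα.trans_le hαβ) d) ?_
  rcases hαβ.eq_or_lt with rfl | h
  · exact Or.inl rfl
  · exact Or.inr (tendsto_tail_ratio hα h c d)

lemma tendsto_two_sided_hazard {α β : ℝ} (hα : 0 < α) (hβ : 0 < β) (c d : ℝ) :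
    Tendsto (fun s =>
      (α * stdNormPDF (α * s + c) / (2 * s) + β * stdNormPDF (β * s + d) / (2 * s)) /
        (stdNormCDF (-(α * s + c)) + stdNormCDF (-(β * s + d))))
      atTop (nhds (min (α ^ 2) (β ^ 2) / 2)) := by
  rcases le_total α β with h | h
  · rw [min_eq_left (by gcongr)]
    exact tendsto_two_sided_hazard_of_le hα h c d
  · rw [min_eq_right (by gcongr)]
    refine (tendsto_two_sided_hazard_of_le hβ h d c).congr fun s => ?_
    rw [add_comm, add_comm (stdNormCDF _)]

lemma hasDerivAt_logit {p : ℝ} (hp : p ∈ Set.Ioo (0 : ℝ) 1) :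
    HasDerivAt logit (p * (1 - p))⁻¹ p := by
  have h0 := hp.1.ne'
  have h1 : 1 - p ≠ 0 := (sub_pos.2 hp.2).ne'
  refine ((Real.hasDerivAt_log h0).sub (((hasDerivAt_id p).const_sub 1).log h1)).congr_deriv ?_
  simp only [id]
  field_simp
  ring

lemma hasDerivAt_stdNormCDF_affine_sqrt (a b : ℝ) {t : ℝ} (ht : 0 < t) :
    HasDerivAt (fun t => stdNormCDF (a * Real.sqrt t + b))
      (a * stdNormPDF (a * Real.sqrt t + b) / (2 * Real.sqrt t)) t := by
  refine ((hasDerivAt_stdNormCDF (a * Real.sqrt t + b)).comp t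
    (((Real.hasDerivAt_sqrt ht.ne').const_mul a).add_const b)).congr_deriv ?_
  ring

lemma stdNormCDF_sub_mem_Ioo {x y : ℝ} (h : x < y) :
    stdNormCDF y - stdNormCDF x ∈ Set.Ioo (0 : ℝ) 1 :=
  ⟨sub_pos.2 (strictMono_stdNormCDF h), by linarith [stdNormCDF_lt_one y, stdNormCDF_pos x]⟩

/-- For a_L < 0 < a_U and b real, f(t) = Φ(a_U√t + b) − Φ(a_L√t + b) lies in
(0,1) for all t > 0, g(t) = logit(f(t)) is differentiable for sufficiently
large t, and lim_{t→∞} g′(t) = min{a_U², a_L²}/2. -/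
theorem stmt7 (aL aU b : ℝ) (haL : aL < 0) (haU : 0 < aU) :
    (∀ t : ℝ, 0 < t →
        stdNormCDF (aU * Real.sqrt t + b) - stdNormCDF (aL * Real.sqrt t + b) ∈
          Set.Ioo (0 : ℝ) 1) ∧
      (∀ᶠ t : ℝ in atTop,
        DifferentiableAt ℝ
          (fun t : ℝ =>
            logit (stdNormCDF (aU * Real.sqrt t + b) - stdNormCDF (aL * Real.sqrt t + b))) t) ∧
      Tendsto
        (deriv fun t : ℝ =>
          logit (stdNormCDF (aU * Real.sqrt t + b) - stdNormCDF (aL * Real.sqrt t + b)))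
        atTop (nhds (min (aU ^ 2) (aL ^ 2) / 2)) := by
  have hmem : ∀ t : ℝ, 0 < t →
      stdNormCDF (aU * Real.sqrt t + b) - stdNormCDF (aL * Real.sqrt t + b) ∈
        Set.Ioo (0 : ℝ) 1 := fun t ht => stdNormCDF_sub_mem_Ioo (by
    have := Real.sqrt_pos.2 ht
    nlinarith)
  have hder := fun (t : ℝ) (ht : 0 < t) => (hasDerivAt_logit (hmem t ht)).comp t
    ((hasDerivAt_stdNormCDF_affine_sqrt aU b ht).sub (hasDerivAt_stdNormCDF_affine_sqrt aL b ht))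
  refine ⟨hmem, (eventually_gt_atTop 0).mono fun t ht => (hder t ht).differentiableAt, ?_⟩
  have hcompl : ∀ s : ℝ, 1 - (stdNormCDF (aU * s + b) - stdNormCDF (aL * s + b)) =
      stdNormCDF (-(aU * s + b)) + stdNormCDF (-(-aL * s + -b)) := fun s => by
    have h : -(-aL * s + -b) = aL * s + b := by ring
    rw [h]
    linarith [stdNormCDF_add_stdNormCDF_neg (aU * s + b)]
  have htail : Tendsto (fun s => stdNormCDF (-(aU * s + b)) + stdNormCDF (-(-aL * s + -b)))
      atTop (nhds 0) := by
    simpa only [add_zero, Function.comp_def] using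
      (tendsto_stdNormCDF_neg_atTop.comp (tendsto_affine_atTop haU b)).add
        (tendsto_stdNormCDF_neg_atTop.comp (tendsto_affine_atTop (neg_pos.2 haL) (-b)))
  have hlim := ((tendsto_two_sided_hazard haU (neg_pos.2 haL) b (-b)).mul
    ((htail.const_sub 1).inv₀ (by norm_num))).comp Real.tendsto_sqrt_atTop
  have e : min (aU ^ 2) ((-aL) ^ 2) / 2 * (1 - 0)⁻¹ = min (aU ^ 2) (aL ^ 2) / 2 := by
    rw [neg_sq]; ring
  rw [e] at hlim
  refine hlim.congr' ?_
  filter_upwards [eventually_gt_atTop 0] with t ht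
  refine Eq.trans ?_ (hder t ht).deriv.symm
  have hsymm : stdNormPDF (-aL * Real.sqrt t + -b) = stdNormPDF (aL * Real.sqrt t + b) := by
    rw [← stdNormPDF_neg]
    ring_nf
  simp only [Function.comp_apply, ← hcompl, hsymm, sub_sub_cancel, mul_inv, div_eq_mul_inv]
  ring
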